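/- (The X-matchings signatures become Pfaffian under the basis change A.) Let A ∈ GL₂(ℂ) act on ℂ² by A|0⟩ = |0⟩ and A|1⟩ = |0⟩ − |1⟩, and let A^∨ = (A⁻¹)ᵀ act on the dual, so that A^∨⟨0| = ⟨0| + ⟨1| and A^∨⟨1| = −⟨1|. Then: (i) for the generator J = ⟨00| + ⟨01| + ⟨10|, one has (A^∨ ⊗ A^∨)(J) = ⟨00| − ⟨11|; and (ii) for every d ≥ 1 and the recognizer G_d = −d·|0⟩^{⊗d} + ∑_{i=1}^{d} |e_i⟩, one has A^{⊗d}(G_d) = −∑_{i=1}^{d} |e_i⟩, where |e_i⟩ denotes the standard basis vector of (ℂ²)^{⊗d} whose bitstring has a single 1 in position i. -/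

import Mathlib

/-- The weight of a bitstring: its number of ones. -/
def wt {n : ℕ} (x : Fin n → Fin 2) : ℕ :=
  (Finset.univ.filter (fun i => x i = 1)).card

/-- The basis change for X-matchings: `A|0⟩ = |0⟩`, `A|1⟩ = |0⟩ − |1⟩`. -/
def Amat : Matrix (Fin 2) (Fin 2) ℂ := !![1, 1; 0, -1]

/-- The inverse-dual `A^∨ = (A⁻¹)ᵀ`, acting on dual vectors so that pairings are
preserved; concretely `A^∨⟨0| = ⟨0| + ⟨1|` and `A^∨⟨1| = −⟨1|`. -/
noncomputable def Adual : Matrix (Fin 2) (Fin 2) ℂ := Amat⁻¹.transpose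

/-- The X-matchings generator `J = ⟨00| + ⟨01| + ⟨10|`. -/
def Jgen : (Fin 2 → Fin 2) → ℂ := fun x => if x = ![1, 1] then 0 else 1

/-- The X-matchings recognizer `G_d = −d·|0…0⟩ + ∑ᵢ |eᵢ⟩` for a degree-`d` vertex. -/
def Grec (d : ℕ) : (Fin d → Fin 2) → ℂ := fun x =>
  if wt x = 0 then -(d : ℂ) else if wt x = 1 then 1 else 0

theorem wt_eq_zero {n : ℕ} (x : Fin n → Fin 2) : wt x = 0 ↔ x = 0 := by
  unfold wt
  rw [Finset.card_eq_zero, Finset.filter_eq_empty_iff]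
  constructor
  · intro h
    funext i
    have := h (Finset.mem_univ i)
    simp only [Pi.zero_apply]
    omega
  · rintro rfl i _
    simp

theorem eq_single_iff {n : ℕ} (x : Fin n → Fin 2) (i : Fin n) :
    x = Pi.single i 1 ↔ Finset.univ.filter (fun j => x j = 1) = {i} := by
  constructor
  · rintro rfl
    ext j
    by_cases h : j = i
    · subst h; simp
    · simp [h]
  · intro h
    funext j
    have hj := Finset.ext_iff.1 h j
    simp only [Finset.mem_filter, Finset.mem_univ, true_and, Finset.mem_singleton] at hj
    by_cases h : j = i
    · subst h; simpa using hj
    · simp only [h, iff_false] at hj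
      rw [Pi.single_eq_of_ne h]
      omega

theorem sum_single {n : ℕ} (x : Fin n → Fin 2) :
    (∑ i, if x = Pi.single i 1 then (1 : ℂ) else 0) = if wt x = 1 then 1 else 0 := by
  simp only [eq_single_iff]
  split_ifs with h
  · obtain ⟨a, ha⟩ := Finset.card_eq_one.1 h
    simp [ha]
  · apply Finset.sum_eq_zero
    intro i _
    rw [if_neg]
    intro hi
    exact h (Finset.card_eq_one.2 ⟨i, hi⟩)

theorem Grec_eq (d : ℕ) (y : Fin d → Fin 2) :
    Grec d y = (if y = 0 then -(d : ℂ) else 0) +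
      ∑ i, if y = Pi.single i 1 then (1 : ℂ) else 0 := by
  rw [sum_single]
  unfold Grec
  simp only [← wt_eq_zero]
  by_cases h : wt y = 0 <;> simp [h]

theorem prod_zero' {d : ℕ} (x : Fin d → Fin 2) :
    ∏ i, Amat (x i) 0 = if x = 0 then 1 else 0 := by
  have h : ∀ a : Fin 2, Amat a 0 = if a = 0 then 1 else 0 := by
    intro a; fin_cases a <;> simp [Amat]
  simp only [h, Finset.prod_boole, funext_iff]
  simp

theorem prod_single' {d : ℕ} (x : Fin d → Fin 2) (i : Fin d) :
    ∏ j, Amat (x j) ((Pi.single i 1 : Fin d → Fin 2) j) =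
      (if x = 0 then 1 else 0) - (if x = Pi.single i 1 then 1 else 0) := by
  by_cases h0 : x = 0
  · subst h0
    have h1 : (0 : Fin d → Fin 2) ≠ Pi.single i 1 := by
      intro h
      have := congrFun h i
      simp at this
    rw [if_pos rfl, if_neg h1, sub_zero]
    apply Finset.prod_eq_one
    intro j _
    generalize (Pi.single i 1 : Fin d → Fin 2) j = b
    fin_cases b <;> simp [Amat]
  · rw [if_neg h0]
    by_cases h1 : x = Pi.single i 1
    · subst h1
      rw [if_pos rfl, Finset.prod_eq_single i]
      · simp [Amat]
      · intro j _ hj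
        simp [hj, Amat]
      · simp
    · rw [if_neg h1, sub_zero]
      have : ∃ j, j ≠ i ∧ x j = 1 := by
        by_contra! hc
        have hz : ∀ j, j ≠ i → x j = 0 := fun j hj => by have := hc j hj; omega
        by_cases hi : x i = 0
        · apply h0
          funext j
          by_cases hj : j = i
          · subst hj; simpa using hi
          · simpa using hz j hj
        · apply h1
          funext j
          by_cases hj : j = i
          · subst hj; rw [Pi.single_eq_same]; omega
          · rw [Pi.single_eq_of_ne hj]; exact hz j hj
      obtain ⟨j, hj, hx⟩ := this
      apply Finset.prod_eq_zero (Finset.mem_univ j)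
      simp [hx, hj, Amat]

theorem Adual_eq : Adual = !![1, 0; 1, -1] := by
  unfold Adual
  have : Amat⁻¹ = Amat := by
    apply Matrix.inv_eq_left_inv
    ext i j
    fin_cases i <;> fin_cases j <;> simp [Amat, Matrix.mul_apply, Fin.sum_univ_two]
  rw [this]
  ext i j
  fin_cases i <;> fin_cases j <;> simp [Amat]

/-- Under the basis change `A`, the X-matchings signatures become Pfaffian:
(i) `(A^∨ ⊗ A^∨)(J) = ⟨00| − ⟨11|`, and (ii) for every `d ≥ 1`,
`A^{⊗d}(G_d) = −∑ᵢ |eᵢ⟩`, the negated sum of the weight-one basis vectors. -/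
theorem xmatchings_basis_change :
    (∀ x : Fin 2 → Fin 2,
        (∑ y : Fin 2 → Fin 2, (Adual (x 0) (y 0) * Adual (x 1) (y 1)) * Jgen y)
          = (if x = ![0, 0] then 1 else if x = ![1, 1] then -1 else 0)) ∧
    (∀ d : ℕ, 1 ≤ d → ∀ x : Fin d → Fin 2,
        (∑ y : Fin d → Fin 2, (∏ i, Amat (x i) (y i)) * Grec d y)
          = -(if wt x = 1 then 1 else 0)) := by
  constructor
  · intro x
    obtain ⟨a, b, rfl⟩ : ∃ a b, x = ![a, b] :=
      ⟨x 0, x 1, by funext i; fin_cases i <;> rfl⟩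
    rw [← (finTwoArrowEquiv (Fin 2)).symm.sum_comp, Fintype.sum_prod_type, Adual_eq]
    simp only [Fin.sum_univ_two, finTwoArrowEquiv, Jgen]
    fin_cases a <;> fin_cases b <;> simp
  · intro d _ x
    simp only [Grec_eq, mul_add, Finset.sum_add_distrib, Finset.mul_sum]
    rw [Finset.sum_comm]
    simp only [mul_ite, mul_one, mul_zero, Finset.sum_ite_eq', Finset.sum_ite_eq,
      Finset.mem_univ, if_true, prod_single', Pi.zero_apply, prod_zero',
      Finset.sum_sub_distrib, sum_single]
    by_cases h : x = 0
    · simp [h]; ring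
    · simp [h]
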